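/- Let m be a σ-finite measure on a measurable space X, f : X → ℝ measurable, q ∈ (0,1), and let p_k and p_{k+1} be probability densities with respect to m. Let W_{p_k}^f be the preference function associated with p_k and the indicator weighting w(u) = 1_{u ≤ q}, set Z := ∫ W_{p_k}^f(x) p_k(x) m(dx), assume Z = q, and let π = W_{p_k}^f p_k / Z be the target density. Assume that for m-a.e. x with π(x) > 0 one has p_k(x) > 0 and p_{k+1}(x) > 0, and that KL(π, p_k) and KL(π, p_{k+1}) are finite. If KL(π, p_{k+1}) + Δ ≤ KL(π, p_k) for some Δ > 0, then Q_{p_{k+1}}^q(f) ≤ Q_{p_k}^q(f). -/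

import Mathlib

open MeasureTheory Set

noncomputable section

variable {X : Type*} [MeasurableSpace X]

/-- `P_{X∼p}[f(X) ≤ u]` for a density `p` w.r.t. `m`. -/
def probLe (m : Measure X) (p f : X → ℝ) (u : ℝ) : ℝ := ∫ x in {y | f y ≤ u}, p x ∂m

/-- `P_{X∼p}[f(X) ≥ u]` for a density `p` w.r.t. `m`. -/
def probGe (m : Measure X) (p f : X → ℝ) (u : ℝ) : ℝ := ∫ x in {y | u ≤ f y}, p x ∂m

/-- The `q`-quantile `Q_p^q(f)`: the supremum of the `u` with
`P[f(X) ≤ u] ≥ q` and `P[f(X) ≥ u] ≥ 1 - q`. -/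
def quantQ (m : Measure X) (p f : X → ℝ) (q : ℝ) : ℝ :=
  sSup {u : ℝ | q ≤ probLe m p f u ∧ 1 - q ≤ probGe m p f u}

/-- `q_p^≤(x) = P_{X∼p}[f(X) ≤ f(x)]`. -/
def qle (m : Measure X) (p f : X → ℝ) (x : X) : ℝ := ∫ y in {y | f y ≤ f x}, p y ∂m

/-- `q_p^<(x) = P_{X∼p}[f(X) < f(x)]`. -/
def qlt (m : Measure X) (p f : X → ℝ) (x : X) : ℝ := ∫ y in {y | f y < f x}, p y ∂m

/-- The preference function `W_p^f` for the indicator weighting `w(u) = 1_{u ≤ q}`. -/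
def prefW (m : Measure X) (p f : X → ℝ) (q : ℝ) (x : X) : ℝ :=
  if qle m p f x = qlt m p f x then (if qle m p f x ≤ q then 1 else 0)
  else (min (qle m p f x) q - min (qlt m p f x) q) / (qle m p f x - qlt m p f x)

lemma aux_quant (m : Measure X) (p f : X → ℝ) (hf : Measurable f) (q : ℝ) (hq : q ∈ Ioo (0:ℝ) 1)
    (hp0 : ∀ x, 0 ≤ p x) (hpi : Integrable p m) (hp1 : ∫ x, p x ∂m = 1) :
    {u : ℝ | q ≤ probLe m p f u ∧ 1 - q ≤ probGe m p f u}.Nonempty ∧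
    BddAbove {u : ℝ | q ≤ probLe m p f u ∧ 1 - q ≤ probGe m p f u} := by
  have key : ∀ s : Set X, MeasurableSet s →
      (m.withDensity (fun x => ENNReal.ofReal (p x))).real s = ∫ x in s, p x ∂m := by
    intro s hs
    rw [Measure.real, withDensity_apply _ hs, integral_eq_lintegral_of_nonneg_ae
      (Filter.Eventually.of_forall hp0) hpi.integrableOn.aestronglyMeasurable]
  have hprob : IsProbabilityMeasure (m.withDensity (fun x => ENNReal.ofReal (p x))) := by
    constructor
    rw [withDensity_apply _ MeasurableSet.univ, Measure.restrict_univ,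
      ← ofReal_integral_eq_lintegral_ofReal hpi (Filter.Eventually.of_forall hp0), hp1]
    simp
  set ν := (m.withDensity (fun x => ENNReal.ofReal (p x))) with hν
  have hμ : IsProbabilityMeasure (ν.map f) := Measure.isProbabilityMeasure_map hf.aemeasurable
  set μ := ν.map f with hμd
  have hle : ∀ u, probLe m p f u = ProbabilityTheory.cdf μ u := by
    intro u
    rw [ProbabilityTheory.cdf_eq_real, hμd, map_measureReal_apply hf measurableSet_Iic,
      key _ (hf measurableSet_Iic)]
    rfl
  have hge : ∀ u, probGe m p f u = 1 - μ.real (Iio u) := by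
    intro u
    have h1 : probGe m p f u = μ.real (Ici u) := by
      rw [hμd, map_measureReal_apply hf measurableSet_Ici, key _ (hf measurableSet_Ici)]
      rfl
    rw [h1, ← compl_Iio, probReal_compl_eq_one_sub measurableSet_Iio]
  simp only [hle, hge]
  have htop := ProbabilityTheory.tendsto_cdf_atTop μ
  have hbot := ProbabilityTheory.tendsto_cdf_atBot μ
  have hmono := ProbabilityTheory.monotone_cdf μ
  constructor
  · set S := {u : ℝ | q ≤ ProbabilityTheory.cdf μ u} with hS
    have hSne : S.Nonempty := by
      obtain ⟨u, hu⟩ := (htop.eventually (lt_mem_nhds hq.2)).exists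
      exact ⟨u, hu.le⟩
    have hSb : BddBelow S := by
      obtain ⟨u, hu⟩ := (hbot.eventually (gt_mem_nhds hq.1)).exists
      refine ⟨u, fun v hv => ?_⟩
      by_contra hlt
      push Not at hlt
      have := hmono hlt.le
      have hv' : q ≤ ProbabilityTheory.cdf μ v := hv
      linarith
    refine ⟨sInf S, ?_, ?_⟩
    · have hr := ((ProbabilityTheory.cdf μ).right_continuous (sInf S)).tendsto
      have hr' := hr.mono_left (nhdsWithin_mono _ Ioi_subset_Ici_self)
      refine ge_of_tendsto hr' ?_
      filter_upwards [self_mem_nhdsWithin] with v hv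
      obtain ⟨w, hw, hwv⟩ := exists_lt_of_csInf_lt hSne hv
      exact le_trans hw (hmono hwv.le)
    · have h1 : μ.real (Iio (sInf S)) = Function.leftLim (ProbabilityTheory.cdf μ) (sInf S) := by
        have h2 := (ProbabilityTheory.cdf μ).measure_Iio hbot (sInf S)
        rw [ProbabilityTheory.measure_cdf] at h2
        rw [Measure.real, h2, sub_zero, ENNReal.toReal_ofReal]
        refine ge_of_tendsto (hmono.tendsto_leftLim _) (Filter.Eventually.of_forall fun v =>
          ProbabilityTheory.cdf_nonneg μ v)
      have h3 : Function.leftLim (ProbabilityTheory.cdf μ) (sInf S) ≤ q := by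
        refine le_of_tendsto (hmono.tendsto_leftLim _) ?_
        filter_upwards [self_mem_nhdsWithin] with v hv
        by_contra hlt
        push Not at hlt
        exact absurd (csInf_le hSb hlt.le) (not_le.mpr hv)
      linarith
  · obtain ⟨u, hu⟩ := (htop.eventually (lt_mem_nhds hq.2)).exists
    refine ⟨u, fun v hv => ?_⟩
    by_contra hlt
    push Not at hlt
    have h1 : μ.real (Iic u) ≤ μ.real (Iio v) :=
      measureReal_mono (fun x hx => lt_of_le_of_lt hx hlt)
    rw [ProbabilityTheory.cdf_eq_real] at hu
    have := hv.2
    linarith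

lemma aux_ge (m : Measure X) (p f : X → ℝ) (hf : Measurable f)
    (hpi : Integrable p m) (hp1 : ∫ x, p x ∂m = 1) (u : ℝ) :
    probGe m p f u = 1 - ∫ x in {y | f y < u}, p x ∂m := by
  have h := integral_add_compl (s := {y | f y < u}) (hf measurableSet_Iio) hpi
  have hc : {y | f y < u}ᶜ = {y | u ≤ f y} := by ext; simp
  rw [hc, hp1] at h
  unfold probGe
  linarith

lemma aux_W (a b q : ℝ) (hab : b ≤ a) :
    0 ≤ (if a = b then (if a ≤ q then (1:ℝ) else 0) else (min a q - min b q) / (a - b)) ∧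
    (if a = b then (if a ≤ q then (1:ℝ) else 0) else (min a q - min b q) / (a - b)) ≤ 1 ∧
    (q < b → (if a = b then (if a ≤ q then (1:ℝ) else 0)
      else (min a q - min b q) / (a - b)) = 0) := by
  by_cases h : a = b
  · subst h
    simp only [if_true]
    refine ⟨by split_ifs <;> norm_num, by split_ifs <;> norm_num, fun h => ?_⟩
    rw [if_neg (not_le.mpr h)]
  · have hlt : 0 < a - b := sub_pos.mpr (lt_of_le_of_ne hab (Ne.symm h))
    simp only [if_neg h]
    refine ⟨div_nonneg (sub_nonneg.mpr (min_le_min_right _ hab)) hlt.le, ?_, fun hb => ?_⟩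
    · rw [div_le_one hlt]
      rcases min_cases a q with h1 | h1 <;> rcases min_cases b q with h2 | h2 <;> linarith
    · rw [min_eq_right hb.le, min_eq_right (hb.le.trans hab)]
      simp

/-- **Corollary 1 (i), KL case.** With the indicator weighting `w(u)=1_{u≤q}`,
target `π = W_{p_k}^f p_k / Z` where `Z = q`, a strict KL decrease
`KL(π, p_{k+1}) + Δ ≤ KL(π, p_k)` with `Δ > 0` implies
`Q_{p_{k+1}}^q(f) ≤ Q_{p_k}^q(f)`. -/
theorem kl_decrease_implies_quantile_improvement
    (m : Measure X) [SigmaFinite m]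
    (f : X → ℝ) (hf : Measurable f) (q : ℝ) (hq : q ∈ Ioo (0:ℝ) 1)
    (pk pk1 : X → ℝ)
    (hpk_meas : Measurable pk) (hpk_nonneg : ∀ x, 0 ≤ pk x)
    (hpk_int : Integrable pk m) (hpk_one : ∫ x, pk x ∂m = 1)
    (hpk1_meas : Measurable pk1) (hpk1_nonneg : ∀ x, 0 ≤ pk1 x)
    (hpk1_int : Integrable pk1 m) (hpk1_one : ∫ x, pk1 x ∂m = 1)
    (Z : ℝ) (hZ_def : Z = ∫ x, prefW m pk f q x * pk x ∂m) (hZ_eq : Z = q)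
    (π : X → ℝ) (hπ : ∀ x, π x = prefW m pk f q x * pk x / Z)
    (hsupp : ∀ᵐ x ∂m, 0 < π x → 0 < pk x ∧ 0 < pk1 x)
    (hKL_k : Integrable (fun x => π x * Real.log (π x / pk x)) m)
    (hKL_k1 : Integrable (fun x => π x * Real.log (π x / pk1 x)) m)
    (Δ : ℝ) (hΔ : 0 < Δ)
    (hdec : (∫ x, π x * Real.log (π x / pk1 x) ∂m) + Δ
        ≤ ∫ x, π x * Real.log (π x / pk x) ∂m) :
    quantQ m pk1 f q ≤ quantQ m pk f q := by
  obtain ⟨hne, hbd⟩ := aux_quant m pk f hf q hq hpk_nonneg hpk_int hpk_one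
  obtain ⟨hne1, -⟩ := aux_quant m pk1 f hf q hq hpk1_nonneg hpk1_int hpk1_one
  refine csSup_le hne1 ?_
  rintro u ⟨-, hu2⟩
  by_contra hlt
  have hlt' : quantQ m pk f q < u := not_le.mp hlt
  rw [aux_ge m pk1 f hf hpk1_int hpk1_one] at hu2
  have mono : ∀ {s t : Set X}, s ⊆ t → ∫ x in s, pk x ∂m ≤ ∫ x in t, pk x ∂m := by
    intro s t hst
    exact setIntegral_mono_set hpk_int.integrableOn
      (Filter.Eventually.of_forall hpk_nonneg) (Filter.Eventually.of_forall hst)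
  have hk : q < ∫ x in {y | f y < u}, pk x ∂m := by
    by_contra hcon
    push Not at hcon
    refine hlt (le_csSup hbd ⟨?_, ?_⟩)
    · obtain ⟨v, hv⟩ := hne
      have hvu : v < u := lt_of_le_of_lt (le_csSup hbd hv) hlt'
      exact hv.1.trans (mono fun x (hx : f x ≤ v) => hx.trans hvu.le)
    · rw [aux_ge m pk f hf hpk_int hpk_one]
      linarith
  have hq0 : 0 < q := hq.1
  subst hZ_eq
  have hW := fun x => aux_W (qle m pk f x) (qlt m pk f x) Z
    (mono fun y (hy : f y < f x) => hy.le)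
  have hW0 : ∀ x, 0 ≤ prefW m pk f Z x := fun x => (hW x).1
  have hW1 : ∀ x, prefW m pk f Z x ≤ 1 := fun x => (hW x).2.1
  have hWz : ∀ x, u ≤ f x → prefW m pk f Z x = 0 := fun x hx => (hW x).2.2
    (lt_of_lt_of_le hk (mono fun y (hy : f y < u) => lt_of_lt_of_le hy hx))
  have hWint : Integrable (fun x => prefW m pk f Z x * pk x) m := by
    by_contra hni
    rw [integral_undef hni] at hZ_def
    exact hq0.ne' hZ_def
  have hπe : π = fun x => prefW m pk f Z x * pk x / Z := funext hπ
  have hπint : Integrable π m := by rw [hπe]; exact hWint.div_const Z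
  have hπ1 : ∫ x, π x ∂m = 1 := by
    rw [hπe, integral_div, ← hZ_def, div_self hq0.ne']
  have hA : MeasurableSet {y | f y < u} := hf measurableSet_Iio
  have hgint : Integrable (fun x => ({y | f y < u} : Set X).indicator pk1 x / Z - π x) m :=
    ((hpk1_int.indicator hA).div_const Z).sub hπint
  have hbound : ∀ᵐ x ∂m, π x * Real.log (π x / pk x) - π x * Real.log (π x / pk1 x)
      ≤ ({y | f y < u} : Set X).indicator pk1 x / Z - π x := by
    filter_upwards [hsupp] with x hx
    have hi0 : 0 ≤ ({y | f y < u} : Set X).indicator pk1 x :=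
      indicator_nonneg (fun y _ => hpk1_nonneg y) x
    have hWi : prefW m pk f Z x * pk1 x ≤ ({y | f y < u} : Set X).indicator pk1 x := by
      by_cases hxu : f x < u
      · rw [indicator_of_mem (show x ∈ {y | f y < u} from hxu)]
        exact mul_le_of_le_one_left (hpk1_nonneg x) (hW1 x)
      · rw [hWz x (not_lt.mp hxu), zero_mul]
        exact hi0
    have hπ0 : 0 ≤ π x := by
      rw [hπ x]
      exact div_nonneg (mul_nonneg (hW0 x) (hpk_nonneg x)) hq0.le
    rcases hπ0.eq_or_lt with h0 | h0
    · rw [← h0]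
      simp only [zero_mul, sub_zero]
      exact div_nonneg hi0 hq0.le
    · obtain ⟨h1, h2⟩ := hx h0
      have hl := Real.log_le_sub_one_of_pos (div_pos h2 h1)
      have hle : Real.log (π x / pk x) - Real.log (π x / pk1 x) = Real.log (pk1 x / pk x) := by
        rw [Real.log_div h0.ne' h1.ne', Real.log_div h0.ne' h2.ne', Real.log_div h2.ne' h1.ne']
        ring
      have h3 : π x * (pk1 x / pk x) = prefW m pk f Z x * pk1 x / Z := by
        rw [hπ x]
        field_simp
      have h4 : prefW m pk f Z x * pk1 x / Z ≤ ({y | f y < u} : Set X).indicator pk1 x / Z :=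
        div_le_div_of_nonneg_right hWi hq0.le
      have h5 := mul_le_mul_of_nonneg_left hl h0.le
      rw [← mul_sub, hle]
      linarith
  have hfin := integral_mono_ae (hKL_k.sub hKL_k1) hgint hbound
  have e1 := integral_sub hKL_k hKL_k1
  have e2 := integral_sub ((hpk1_int.indicator hA).div_const Z) hπint
  simp only [Pi.sub_apply] at hfin
  rw [e1, e2, integral_div, integral_indicator hA, hπ1] at hfin
  have h6 : (∫ x in {y | f y < u}, pk1 x ∂m) / Z ≤ 1 := by
    rw [div_le_one hq0]
    linarith
  linarith
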